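/- arXiv:2406.17121 — 3 statements merged into one kernel-verified Lean document; each statement's English description precedes it below -/
import Mathlib

section
/- (FlushWhenFull is (k+1)/(k(1−r))-competitive in the discrete k-wallet model.) Let C, T > 0 be reals, k ≥ 2 an integer, F ≥ 1 an integer flush period, and set r = kT/C; assume r < 1. Then there is a constant c₀ ≥ 0 depending only on C, T, k, F such that for every n and every transaction sequence tx of length n with maximum transaction size T, OPT_D(C,k;tx) ≤ ((k+1)/(k(1−r))) · V_FWF(tx) + c₀. -/
open Finset

noncomputable section

/-! ### The discrete `k`-wallet model -/

/-- Wallet `i` is offline at time `t`: some flush time `t' ∈ Φ i` satisfies `t' < t ≤ t' + F`. -/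
def WalletOffline (F : ℕ) (Φ : ℕ → Finset ℕ) (i t : ℕ) : Prop :=
  ∃ t' ∈ Φ i, t' < t ∧ t ≤ t' + F

/-- A feasible execution in the discrete `k`-wallet model with integer flush period `F`,
total collateral `C` (each wallet has size `C / k`), over time slots `1,…,n`, on the
transaction sequence `tx`.  It consists of a settlement assignment
`s : ℕ → Option ℕ` (wallet indices are `0,…,k-1`) and flush-time sets `Φ i`.
Whenever `s t = some i`, wallet `i` must be online at `t` and the total value settled in
wallet `i` since the wallet's last flush strictly before `t` (including `tx t`) is at
most `C / k`. -/
def DFeasible (F : ℕ) (C : ℝ) (k n : ℕ) (tx : ℕ → ℝ)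
    (s : ℕ → Option ℕ) (Φ : ℕ → Finset ℕ) : Prop :=
  (∀ i, Φ i ⊆ Finset.Icc 1 n) ∧
  (∀ t i, s t = some i → i < k ∧ t ∈ Finset.Icc 1 n) ∧
  (∀ t i, s t = some i →
    ¬ WalletOffline F Φ i t ∧
    (∑ t' ∈ (Finset.Icc 1 t).filter
        (fun t' => s t' = some i ∧ ∀ u ∈ Φ i, ¬ (t' ≤ u ∧ u < t)), tx t') ≤ C / k)

/-- The total value settled by an execution with settlement assignment `s`. -/
def DValue (n : ℕ) (tx : ℕ → ℝ) (s : ℕ → Option ℕ) : ℝ :=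
  ∑ t ∈ (Finset.Icc 1 n).filter (fun t => (s t).isSome), tx t

/-! ### The `FlushAll` algorithm -/

/-- The state of the `FlushAll` algorithm: remaining wallet capacities, the time until which
all wallets are offline (inclusive), and the total value settled so far. -/
structure FAState where
  cap : ℕ → ℝ
  offlineUntil : ℕ
  settled : ℝ

/-- One step of `FlushAll` (with `k` wallets of size `C / k` and flush period `F`) at time
`t` on a transaction of value `v`: if the wallets are offline, discard; else settle in the
least-index wallet that fits, if any; otherwise discard and flush all wallets. -/
def faStep (C : ℝ) (k F : ℕ) (st : FAState) (t : ℕ) (v : ℝ) : FAState :=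
  if t ≤ st.offlineUntil then st
  else if h : ∃ i, i < k ∧ v ≤ st.cap i then
    let i := Nat.find h
    { st with cap := fun j => if j = i then st.cap i - v else st.cap j,
              settled := st.settled + v }
  else
    { cap := fun _ => C / k, offlineUntil := t + F, settled := st.settled }

/-- The state of `FlushAll` after processing `tx 1, …, tx n`. -/
def faRun (C : ℝ) (k F n : ℕ) (tx : ℕ → ℝ) : FAState :=
  (List.range n).foldl (fun st j => faStep C k F st (j + 1) (tx (j + 1)))
    { cap := fun _ => C / k, offlineUntil := 0, settled := 0 }

/-- `V_FA(tx)`: the total value settled by `FlushAll`. -/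
def VFA (C : ℝ) (k F n : ℕ) (tx : ℕ → ℝ) : ℝ := (faRun C k F n tx).settled

/-! ### The `FlushWhenFull` algorithm -/

/-- The state of `FlushWhenFull`: the active wallet's remaining capacity, a counter whose
value mod `k` is the active wallet, per-wallet offline deadlines, and the settled value. -/
structure FWFState where
  cap : ℝ
  active : ℕ
  offlineUntil : ℕ → ℕ
  settled : ℝ

/-- One step of `FlushWhenFull` (with `k` wallets of size `C / k` and flush period `F`). -/
def fwfStep (C : ℝ) (k F : ℕ) (st : FWFState) (t : ℕ) (v : ℝ) : FWFState :=
  if t ≤ st.offlineUntil (st.active % k) then st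
  else if v ≤ st.cap then { st with cap := st.cap - v, settled := st.settled + v }
  else
    { cap := C / k, active := st.active + 1,
      offlineUntil := fun j => if j = st.active % k then t + F else st.offlineUntil j,
      settled := st.settled }

/-- The state of `FlushWhenFull` after processing `tx 1, …, tx n`. -/
def fwfRun (C : ℝ) (k F n : ℕ) (tx : ℕ → ℝ) : FWFState :=
  (List.range n).foldl (fun st j => fwfStep C k F st (j + 1) (tx (j + 1)))
    { cap := C / k, active := 0, offlineUntil := fun _ => 0, settled := 0 }

/-- `V_FWF(tx)`: the total value settled by `FlushWhenFull`. -/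
def VFWF (C : ℝ) (k F n : ℕ) (tx : ℕ → ℝ) : ℝ := (fwfRun C k F n tx).settled

/-! ### The `FlushTwoWhenFull` algorithm -/

/-- The state of `FlushTwoWhenFull`: capacities of the two wallets of the active pair,
a counter whose value mod `k / 2` is the active pair, per-pair offline deadlines, and the
settled value. -/
structure FTWFState where
  cap1 : ℝ
  cap2 : ℝ
  active : ℕ
  offlineUntil : ℕ → ℕ
  settled : ℝ

/-- One step of `FlushTwoWhenFull` (with `k` wallets of size `C / k`, grouped into `k / 2`
pairs, and flush period `F`). -/
def ftwfStep (C : ℝ) (k F : ℕ) (st : FTWFState) (t : ℕ) (v : ℝ) : FTWFState :=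
  if t ≤ st.offlineUntil (st.active % (k / 2)) then st
  else if v ≤ st.cap1 then { st with cap1 := st.cap1 - v, settled := st.settled + v }
  else if v ≤ st.cap2 then { st with cap2 := st.cap2 - v, settled := st.settled + v }
  else
    { cap1 := C / k, cap2 := C / k, active := st.active + 1,
      offlineUntil := fun j => if j = st.active % (k / 2) then t + F else st.offlineUntil j,
      settled := st.settled }

/-- The state of `FlushTwoWhenFull` after processing `tx 1, …, tx n`. -/
def ftwfRun (C : ℝ) (k F n : ℕ) (tx : ℕ → ℝ) : FTWFState :=
  (List.range n).foldl (fun st j => ftwfStep C k F st (j + 1) (tx (j + 1)))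
    { cap1 := C / k, cap2 := C / k, active := 0, offlineUntil := fun _ => 0, settled := 0 }

/-- `V_FTWF(tx)`: the total value settled by `FlushTwoWhenFull`. -/
def VFTWF (C : ℝ) (k F n : ℕ) (tx : ℕ → ℝ) : ℝ := (ftwfRun C k F n tx).settled

/-! ### The general collateral model -/

/-- A feasible settled set in the general collateral model with collateral `C` and flush
period `F`: for every `t ∈ S`, the total settled value in the window `[t - F, t]` is at
most `C`. -/
def GFeasible (F : ℕ) (C : ℝ) (n : ℕ) (tx : ℕ → ℝ) (S : Finset ℕ) : Prop :=
  S ⊆ Finset.Icc 1 n ∧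
  ∀ t ∈ S, (∑ t' ∈ S.filter (fun t' => t - F ≤ t' ∧ t' ≤ t), tx t') ≤ C

/-- The total value of a settled set. -/
def GValue (tx : ℕ → ℝ) (S : Finset ℕ) : ℝ := ∑ t ∈ S, tx t

/-! ### The threshold algorithm `A_η` -/

/-- The state of the threshold algorithm `A_η`: available collateral `avail`,
committed-but-unflushed collateral `committed`, total settled value, number of flushes
performed, and `ret u` is the amount of flushed collateral returning to availability at
time `u`. -/
structure EtaState where
  avail : ℝ
  committed : ℝ
  settled : ℝ
  flushes : ℕ
  ret : ℕ → ℝ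

/-- One step of `A_η` (collateral `C`, threshold `η`, flush period `F`) at time `t` on a
transaction of value `v`: first any returning collateral is added back; the transaction is
settled iff the available collateral covers it; after settling, if the committed collateral
reaches `η C`, exactly `η C` is flushed, returning at time `t + F + 1`. -/
def etaStep (C η : ℝ) (F : ℕ) (st : EtaState) (t : ℕ) (v : ℝ) : EtaState :=
  let U := st.avail + st.ret t
  if v ≤ U then
    if η * C ≤ st.committed + v then
      { avail := U - v, committed := st.committed + v - η * C,
        settled := st.settled + v, flushes := st.flushes + 1,
        ret := fun u => if u = t + F + 1 then st.ret u + η * C else st.ret u }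
    else
      { avail := U - v, committed := st.committed + v,
        settled := st.settled + v, flushes := st.flushes, ret := st.ret }
  else { st with avail := U }

/-- The state of `A_η` after processing `tx 1, …, tx n`. -/
def etaRun (C η : ℝ) (F n : ℕ) (tx : ℕ → ℝ) : EtaState :=
  (List.range n).foldl (fun st j => etaStep C η F st (j + 1) (tx (j + 1)))
    { avail := C, committed := 0, settled := 0, flushes := 0, ret := fun _ => 0 }

/-- `V_{A_η}(tx)`: the total value settled by the threshold algorithm `A_η`. -/
def VEta (C η : ℝ) (F n : ℕ) (tx : ℕ → ℝ) : ℝ := (etaRun C η F n tx).settled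

/-- `f_{A_η}(tx)`: the number of flushes performed by the threshold algorithm `A_η`. -/
def fEta (C η : ℝ) (F n : ℕ) (tx : ℕ → ℝ) : ℕ := (etaRun C η F n tx).flushes

/-! ### The general collateral model with profit margin and flush cost -/

/-- A feasible execution in the general collateral model with collateral `C` and flush
period `F`: a settled set `S ⊆ {1,…,n}` and a list `L` of flush events `(tⱼ, aⱼ)` with
`tⱼ ∈ {1,…,n}` and `aⱼ > 0`, such that (i) at every time `t` the total amount flushed by
time `t` is at most the total value settled by time `t`, and (ii) for every `t ∈ S` the
total value settled by time `t` minus the total amount whose flush period has completed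
before `t` is at most `C`. -/
def PFeasible (F : ℕ) (C : ℝ) (n : ℕ) (tx : ℕ → ℝ) (S : Finset ℕ)
    (L : List (ℕ × ℝ)) : Prop :=
  S ⊆ Finset.Icc 1 n ∧
  (∀ e ∈ L, e.1 ∈ Finset.Icc 1 n ∧ 0 < e.2) ∧
  (∀ t : ℕ, ((L.filter (fun e => decide (e.1 ≤ t))).map Prod.snd).sum ≤
      ∑ t' ∈ S.filter (fun t' => t' ≤ t), tx t') ∧
  (∀ t ∈ S, (∑ t' ∈ S.filter (fun t' => t' ≤ t), tx t')
      - ((L.filter (fun e => decide (e.1 + F < t))).map Prod.snd).sum ≤ C)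

/-- The profit of an execution: `p · (total settled value) − τ · (number of flushes)`. -/
def PProfit (p τ : ℝ) (tx : ℕ → ℝ) (S : Finset ℕ) (L : List (ℕ × ℝ)) : ℝ :=
  p * ∑ t ∈ S, tx t - τ * L.length

/-! ### Deterministic online 1-wallet algorithms -/

/-- A deterministic online 1-wallet algorithm: at each time `t` it decides, as a function
of the prefix `(tx 1, …, tx t)`, whether to settle `tx t` and whether to flush the wallet
at time `t`. -/
structure OnlineAlg where
  settles : List ℝ → Bool
  flushes : List ℝ → Bool

/-- The prefix `[tx 1, …, tx t]` of a transaction sequence. -/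
def prefixList (tx : ℕ → ℝ) (t : ℕ) : List ℝ := (List.range t).map (fun j => tx (j + 1))

/-- The settlement assignment induced by a deterministic online 1-wallet algorithm. -/
def inducedS (A : OnlineAlg) (n : ℕ) (tx : ℕ → ℝ) : ℕ → Option ℕ := fun t =>
  if t ∈ Finset.Icc 1 n ∧ A.settles (prefixList tx t) then some 0 else none

/-- The flush-time sets induced by a deterministic online 1-wallet algorithm. -/
def inducedPhi (A : OnlineAlg) (n : ℕ) (tx : ℕ → ℝ) : ℕ → Finset ℕ := fun _ =>
  (Finset.Icc 1 n).filter (fun t => A.flushes (prefixList tx t))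

/-- `V_A(tx)`: the total value settled by the online algorithm `A` on `tx`. -/
def VOnline (A : OnlineAlg) (n : ℕ) (tx : ℕ → ℝ) : ℝ := DValue n tx (inducedS A n tx)

end

/-- Distinct indices that differ by less than `k` have distinct residues modulo `k`. -/
theorem mod_ne_mod_of_lt_add {a i k : ℕ} (h₁ : a < i) (h₂ : i < a + k) : i % k ≠ a % k := by
  intro h
  have hd : k ∣ i - a := (Nat.modEq_iff_dvd' h₁.le).mp h.symm
  have := Nat.le_of_dvd (by omega) hd
  omega

theorem fwfRun_succ (C : ℝ) (k F n : ℕ) (tx : ℕ → ℝ) :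
    fwfRun C k F (n + 1) tx = fwfStep C k F (fwfRun C k F n tx) (n + 1) (tx (n + 1)) := by
  simp [fwfRun, List.range_succ]

theorem DValue_succ (n : ℕ) (tx : ℕ → ℝ) (s : ℕ → Option ℕ) :
    DValue (n + 1) tx s = DValue n tx s + if (s (n + 1)).isSome then tx (n + 1) else 0 := by
  simp [DValue, Finset.sum_filter, Finset.sum_Icc_succ_top]

theorem DValue_add_sum_Ioc {a b : ℕ} (hab : a ≤ b) (tx : ℕ → ℝ) (s : ℕ → Option ℕ) :
    DValue b tx s =
      DValue a tx s + ∑ t ∈ (Finset.Ioc a b).filter (fun t => (s t).isSome), tx t := by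
  induction b, hab using Nat.le_induction with
  | base => simp
  | succ b hb ih =>
    rw [DValue_succ, ih, Finset.sum_filter, Finset.sum_filter, Finset.sum_Ioc_succ_top hb]
    ring

theorem DFeasible.DValue_mono {F k n : ℕ} {C : ℝ} {tx : ℕ → ℝ} {s : ℕ → Option ℕ}
    {Φ : ℕ → Finset ℕ} (h : DFeasible F C k n tx s Φ)
    (htx : ∀ t ∈ Finset.Icc 1 n, 0 ≤ tx t) : Monotone fun t => DValue t tx s := by
  intro a b hab
  dsimp only
  rw [DValue_add_sum_Ioc hab]
  refine le_add_of_nonneg_right (Finset.sum_nonneg fun t ht => ?_)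
  obtain ⟨i, hi⟩ := Option.isSome_iff_exists.mp (Finset.mem_filter.mp ht).2
  exact htx t (h.2.1 t i hi).2

/-- During `F` consecutive slots a single wallet settles at most its size. -/
theorem DFeasible.sum_wallet_Ioc_le {F k n : ℕ} {C : ℝ} {tx : ℕ → ℝ} {s : ℕ → Option ℕ}
    {Φ : ℕ → Finset ℕ} (h : DFeasible F C k n tx s Φ) (hC : 0 ≤ C)
    (htx : ∀ t ∈ Finset.Icc 1 n, 0 ≤ tx t) {a b : ℕ} (hbF : b ≤ a + F) (i : ℕ) :
    ∑ t ∈ (Finset.Ioc a b).filter (fun t => s t = some i), tx t ≤ C / k := by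
  obtain hS | hS := ((Finset.Ioc a b).filter (fun t => s t = some i)).eq_empty_or_nonempty
  · rw [hS, Finset.sum_empty]
    positivity
  · obtain ⟨m, hm, hmax⟩ := Finset.exists_max_image _ id hS
    simp only [Finset.mem_filter, Finset.mem_Ioc, id] at hm hmax
    obtain ⟨hon, hsum⟩ := h.2.2 m i hm.2
    refine le_trans (Finset.sum_le_sum_of_subset_of_nonneg ?_ ?_) hsum
    · intro t ht
      simp only [Finset.mem_filter, Finset.mem_Ioc, Finset.mem_Icc] at ht ⊢
      have htm := hmax t ht
      refine ⟨⟨by omega, htm⟩, ht.2, fun u hu hlt => hon ⟨u, hu, hlt.2, by omega⟩⟩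
    · intro t ht _
      simp only [Finset.mem_filter] at ht
      exact htx t (h.2.1 t i ht.2.1).2

/-- During `F` consecutive slots a feasible execution settles at most the total collateral. -/
theorem DFeasible.DValue_le_add {F k n : ℕ} {C : ℝ} {tx : ℕ → ℝ} {s : ℕ → Option ℕ}
    {Φ : ℕ → Finset ℕ} (h : DFeasible F C k n tx s Φ) (hC : 0 ≤ C) (hk : k ≠ 0)
    (htx : ∀ t ∈ Finset.Icc 1 n, 0 ≤ tx t) {a b : ℕ} (hab : a ≤ b) (hbF : b ≤ a + F) :
    DValue b tx s ≤ DValue a tx s + C := by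
  have hunion : (Finset.Ioc a b).filter (fun t => (s t).isSome) =
      (Finset.range k).biUnion (fun i => (Finset.Ioc a b).filter (fun t => s t = some i)) := by
    ext t
    simp only [Finset.mem_filter, Finset.mem_biUnion, Finset.mem_range, Option.isSome_iff_exists]
    constructor
    · rintro ⟨ht, i, hi⟩
      exact ⟨i, (h.2.1 t i hi).1, ht, hi⟩
    · rintro ⟨i, -, ht, hi⟩
      exact ⟨ht, i, hi⟩
  have hdisj : (↑(Finset.range k) : Set ℕ).PairwiseDisjoint
      (fun i => (Finset.Ioc a b).filter (fun t => s t = some i)) := by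
    intro i _ j _ hij
    refine Finset.disjoint_left.mpr fun t hi hj => hij ?_
    simp only [Finset.mem_filter] at hi hj
    exact Option.some.inj (hi.2.symm.trans hj.2)
  rw [DValue_add_sum_Ioc hab, hunion, Finset.sum_biUnion hdisj, add_le_add_iff_left]
  calc _ ≤ ∑ _i ∈ Finset.range k, C / k :=
        Finset.sum_le_sum fun i _ => h.sum_wallet_Ioc_le hC htx hbF i
    _ = C := by
        rw [Finset.sum_const, Finset.card_range, nsmul_eq_mul]
        field_simp

/-- Invariant relating the state `st` of `FlushWhenFull` after slot `t` to the value `P` settled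
by a competing execution.  Here `f i` is the time of the `i`-th flush (with `f 0 = 0`), `U i` is
the value settled by `FlushWhenFull` up to that time, `w` is the wallet size and `R` is the
competitive ratio. -/
structure FWFInvariant (w T R : ℝ) (k F : ℕ) (P : ℕ → ℝ) (t : ℕ) (st : FWFState)
    (f : ℕ → ℕ) (U : ℕ → ℝ) : Prop where
  flush_le : ∀ i ≤ st.active, f i ≤ t
  gain : ∀ i j, i ≤ j → j ≤ st.active → ((j : ℝ) - i) * (w - T) ≤ U j - U i
  bound : ∀ i ≤ st.active, P (f i) ≤ R * U i
  cap_eq : st.cap = w - (st.settled - U st.active)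
  cap_nonneg : 0 ≤ st.cap
  le_settled : U st.active ≤ st.settled
  offline : ∀ i, st.active ≤ i → i < st.active + k →
    st.offlineUntil (i % k) = if i < k then 0 else f (i - k + 1) + F
  current : P t ≤ P (max (st.offlineUntil (st.active % k)) (f st.active)) +
    (st.settled - U st.active)

/-- The value lost to one completed wallet: `S` is the value settled in it and `v` is the
transaction that triggered the flush. -/
theorem phase_le {w T S v : ℝ} (hT : 0 ≤ T) (hTw : T < w) (hv : v ≤ T) (hS : w - v ≤ S) :
    S + v ≤ w / (w - T) * S := by
  have h : 0 < w - T := by linarith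
  rw [div_mul_eq_mul_div, le_div_iff₀ h]
  nlinarith [mul_nonneg hT (sub_nonneg.mpr hS), mul_nonneg hT (sub_nonneg.mpr hv),
    mul_nonneg h.le (sub_nonneg.mpr hv)]

/-- A block of `k` completed wallets pays for the total collateral and one phase. -/
theorem block_le {w T S : ℝ} {k : ℕ} (hT : 0 ≤ T) (hTw : T < w) (hk : 0 < k)
    (hS : w - T ≤ S) :
    k * w + w / (w - T) * S ≤
      ((k + 1) / k * (w / (w - T))) * (S + (k - 1) * (w - T)) := by
  have h : 0 < w - T := by linarith
  have hk' : (0 : ℝ) < k := by exact_mod_cast hk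
  have hA : w ≤ w / (w - T) * S := by
    rw [div_mul_eq_mul_div, le_div_iff₀ h]
    exact mul_le_mul_of_nonneg_left hS (by linarith)
  have e : ((k + 1) / k * (w / (w - T))) * (S + (k - 1) * (w - T)) -
      (k * w + w / (w - T) * S) = (w / (w - T) * S - w) / k := by
    field_simp
    ring
  have : 0 ≤ (w / (w - T) * S - w) / k := div_nonneg (by linarith) hk'.le
  linarith

theorem FWFInvariant.init {w T R : ℝ} {k F : ℕ} {P : ℕ → ℝ} (hw : 0 ≤ w) (hP : P 0 = 0) :
    FWFInvariant w T R k F P 0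
      { cap := w, active := 0, offlineUntil := fun _ => 0, settled := 0 }
      (fun _ => 0) (fun _ => 0) where
  flush_le := by simp
  gain := by
    intro i j hij hj
    obtain rfl : j = 0 := by simpa using hj
    obtain rfl : i = 0 := by omega
    simp
  bound := by simp [hP]
  cap_eq := by simp
  cap_nonneg := hw
  le_settled := le_rfl
  offline := by
    intro i _ hi
    have : i < k := by simpa using hi
    simp [this]
  current := by simp

/-- If the competing execution gains at most `v` in slot `t + 1` and at most `k * w` in any `F`
consecutive slots, one step of `FlushWhenFull` preserves the invariant. -/
theorem FWFInvariant.step {w T R C v : ℝ} {k F t : ℕ} {P : ℕ → ℝ} {st : FWFState}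
    {f : ℕ → ℕ} {U : ℕ → ℝ} (h : FWFInvariant w T R k F P t st f U)
    (hk : 0 < k) (hT : 0 ≤ T) (hTw : T < w) (hw : w = C / k)
    (hR : R = (k + 1) / k * (w / (w - T)))
    (hv0 : 0 ≤ v) (hvT : v ≤ T) (hPv : P (t + 1) ≤ P t + v) (hmono : Monotone P)
    (hwin : ∀ a, P (a + F) ≤ P a + k * w) :
    ∃ f' U', FWFInvariant w T R k F P (t + 1) (fwfStep C k F st (t + 1) v) f' U' := by
  obtain ⟨hfle, hgain, hbound, hcap, hcap0, hle, hoff, hcur⟩ := h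
  have hkR : (0 : ℝ) < k := by exact_mod_cast hk
  have hTw' : 0 < w - T := by linarith
  unfold fwfStep
  split_ifs with h₁ h₂
  · refine ⟨f, U, fun i hi => (hfle i hi).trans (Nat.le_succ t), hgain, hbound, hcap,
      hcap0, hle, hoff, ?_⟩
    have : P (t + 1) ≤ P (max (st.offlineUntil (st.active % k)) (f st.active)) :=
      hmono (h₁.trans (le_max_left _ _))
    linarith
  · refine ⟨f, U, fun i hi => (hfle i hi).trans (Nat.le_succ t), hgain, hbound, ?_, ?_, ?_,
      hoff, ?_⟩ <;> dsimp only at *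
    · rw [hcap]; ring
    · linarith
    · linarith
    · linarith
  · obtain ⟨c, a, off, V⟩ := st
    dsimp only at *
    have hS : w - v ≤ V - U a := by linarith
    have hphase := phase_le hT hTw hvT hS
    have hA : w / (w - T) ≤ R := by
      have : 0 ≤ w / (w - T) := div_nonneg (by linarith) hTw'.le
      rw [hR, add_div, div_self hkR.ne', add_mul, one_mul]
      exact le_add_of_nonneg_right (by positivity)
    have hnew : P (t + 1) ≤ R * V := by
      rcases le_total (off (a % k)) (f a) with hd | hd
      · rw [max_eq_right hd] at hcur
        have := hbound a le_rfl
        have := mul_le_mul_of_nonneg_right hA (by linarith : 0 ≤ V - U a)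
        linarith
      · rw [max_eq_left hd] at hcur
        have ho := hoff a le_rfl (by omega)
        split_ifs at ho with hak
        · have : P (off (a % k)) ≤ P (f a) := hmono (by omega)
          have := hbound a le_rfl
          have := mul_le_mul_of_nonneg_right hA (by linarith : 0 ≤ V - U a)
          linarith
        · rw [ho] at hcur
          have hb := hbound (a - k + 1) (by omega)
          have hg := hgain (a - k + 1) a (by omega) le_rfl
          have hcast : ((a : ℝ) - ((a - k + 1 : ℕ) : ℝ)) = k - 1 := by
            rw [Nat.cast_add, Nat.cast_sub (by omega)]
            push_cast
            ring
          rw [hcast] at hg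
          have hblock := block_le hT hTw hk (by linarith : w - T ≤ V - U a)
          rw [← hR] at hblock
          have hR0 : 0 ≤ R := le_trans (div_nonneg (by linarith) hTw'.le) hA
          have := mul_le_mul_of_nonneg_left
            (by linarith : (V - U a) + (k - 1) * (w - T) ≤ V - U (a - k + 1)) hR0
          have := hwin (f (a - k + 1))
          linarith
    have hf : ∀ i ≤ a, Function.update f (a + 1) (t + 1) i = f i := fun i hi =>
      Function.update_of_ne (by omega) _ _
    have hU : ∀ i ≤ a, Function.update U (a + 1) V i = U i := fun i hi =>
      Function.update_of_ne (by omega) _ _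
    refine ⟨Function.update f (a + 1) (t + 1), Function.update U (a + 1) V, ?_⟩
    constructor <;> dsimp only
    · intro i hi
      rcases Nat.le_or_eq_of_le_succ hi with hi | rfl
      · rw [hf i hi]
        exact (hfle i hi).trans (Nat.le_succ t)
      · simp
    · intro i j hij hj
      rcases Nat.le_or_eq_of_le_succ hj with hj | rfl
      · rw [hU i (hij.trans hj), hU j hj]
        exact hgain i j hij hj
      · rcases Nat.le_or_eq_of_le_succ hij with hi | rfl
        · rw [hU i hi, Function.update_self]
          have := hgain i a hi le_rfl
          push_cast
          linarith
        · simp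
    · intro i hi
      rcases Nat.le_or_eq_of_le_succ hi with hi | rfl
      · rw [hf i hi, hU i hi]
        exact hbound i hi
      · simpa using hnew
    · simp [hw]
    · rw [← hw]
      linarith
    · simp
    · intro i hi hik
      rcases Nat.lt_or_ge i (a + k) with hlt | hge
      · rw [if_neg (mod_ne_mod_of_lt_add hi hlt), hoff i (by omega) hlt]
        split_ifs with hik'
        · rfl
        · rw [hf _ (by omega)]
      · obtain rfl : i = a + k := by omega
        simp
    · have : P (t + 1) ≤ P (max (if (a + 1) % k = a % k then t + 1 + F else off ((a + 1) % k))
          (Function.update f (a + 1) (t + 1) (a + 1))) := by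
        refine hmono (le_trans ?_ (le_max_right _ _))
        simp
      simpa using this

/-- The invariant bounds the competing value by `R` times the settled value plus the total
collateral. -/
theorem FWFInvariant.le_mul_settled_add {w T R : ℝ} {k F t : ℕ} {P : ℕ → ℝ} {st : FWFState}
    {f : ℕ → ℕ} {U : ℕ → ℝ} (h : FWFInvariant w T R k F P t st f U)
    (hk : 0 < k) (hw : 0 < w) (hTw : T ≤ w) (hR : 1 ≤ R) (hmono : Monotone P)
    (hwin : ∀ a, P (a + F) ≤ P a + k * w) :
    P t ≤ R * st.settled + k * w := by
  obtain ⟨c, a, off, V⟩ := st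
  obtain ⟨-, hgain, hbound, -, -, hle, hoff, hcur⟩ := h
  dsimp only at *
  have hV := le_mul_of_one_le_left (sub_nonneg.mpr hle) hR
  have hkw : 0 ≤ k * w := by positivity
  suffices hP : P (max (off (a % k)) (f a)) ≤ R * U a + k * w by linarith
  have ha := hbound a le_rfl
  rcases le_total (off (a % k)) (f a) with hd | hd
  · rw [max_eq_right hd]
    linarith
  · rw [max_eq_left hd]
    have ho := hoff a le_rfl (by omega)
    split_ifs at ho with hak
    · have : P (off (a % k)) ≤ P (f a) := hmono (by omega)
      linarith
    · rw [ho]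
      have hb := hbound (a - k + 1) (by omega)
      have hg := hgain (a - k + 1) a (by omega) le_rfl
      have hcast : (((a - k + 1 : ℕ) : ℝ)) ≤ a := by exact_mod_cast (by omega)
      have hg' := (mul_nonneg (sub_nonneg.mpr hcast) (sub_nonneg.mpr hTw)).trans hg
      have := mul_le_mul_of_nonneg_left (sub_nonneg.mp hg') (by linarith : 0 ≤ R)
      have := hwin (f (a - k + 1))
      linarith

/-- `FlushWhenFull` is `(k+1)/(k(1 − r))`-competitive in the discrete
`k`-wallet model, where `r = kT/C < 1` and `k ≥ 2`. -/
theorem flushWhenFull_competitive (C T : ℝ) (k F : ℕ)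
    (hC : 0 < C) (hT : 0 < T) (hk : 2 ≤ k) (hF : 1 ≤ F)
    (hr : (k : ℝ) * T / C < 1) :
    ∃ c₀ : ℝ, 0 ≤ c₀ ∧ ∀ (n : ℕ) (tx : ℕ → ℝ),
      (∀ t ∈ Finset.Icc 1 n, 0 ≤ tx t ∧ tx t ≤ T) →
      ∀ (s : ℕ → Option ℕ) (Φ : ℕ → Finset ℕ), DFeasible F C k n tx s Φ →
        DValue n tx s ≤
          (((k : ℝ) + 1) / ((k : ℝ) * (1 - (k : ℝ) * T / C))) * VFWF C k F n tx + c₀ := by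
  have hk0 : 0 < k := by omega
  have hkR : (0 : ℝ) < k := by exact_mod_cast hk0
  obtain ⟨w, hw⟩ : ∃ w, w = C / k := ⟨_, rfl⟩
  have hCw : C = k * w := by
    rw [hw]
    field_simp
  have hw0 : 0 < w := by
    rw [hw]
    positivity
  have hrw : (k : ℝ) * T / C = T / w := by
    rw [hCw]
    field_simp
  rw [hrw] at hr ⊢
  have hTw : T < w := by rwa [div_lt_one hw0] at hr
  have hTw' : 0 < w - T := by linarith
  obtain ⟨R, hR⟩ : ∃ R : ℝ, R = (k + 1) / k * (w / (w - T)) := ⟨_, rfl⟩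
  have hR' : ((k : ℝ) + 1) / (k * (1 - T / w)) = R := by
    rw [hR, one_sub_div hw0.ne']
    field_simp
  have hR1 : 1 ≤ R := by
    rw [hR]
    refine one_le_mul_of_one_le_of_one_le ?_ ?_
    · rw [one_le_div hkR]
      linarith
    · rw [one_le_div hTw']
      linarith
  rw [hR']
  refine ⟨C, hC.le, fun n tx htx s Φ hfeas => ?_⟩
  have htx0 : ∀ t ∈ Finset.Icc 1 n, 0 ≤ tx t := fun t ht => (htx t ht).1
  have hmono := hfeas.DValue_mono htx0
  have hwin : ∀ a, DValue (a + F) tx s ≤ DValue a tx s + k * w := fun a => by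
    rw [← hCw]
    exact hfeas.DValue_le_add hC.le hk0.ne' htx0 (Nat.le_add_right a F) le_rfl
  have hinv : ∀ t ≤ n, ∃ f U,
      FWFInvariant w T R k F (fun t => DValue t tx s) t (fwfRun C k F t tx) f U := by
    intro t
    induction t with
    | zero =>
      intro _
      refine ⟨fun _ => 0, fun _ => 0, ?_⟩
      simpa [fwfRun, hw] using FWFInvariant.init (T := T) (R := R) (k := k) (F := F)
        (P := fun t => DValue t tx s) hw0.le (by simp [DValue])
    | succ t ih =>
      intro ht
      obtain ⟨f, U, h⟩ := ih (by omega)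
      obtain ⟨hv0, hvT⟩ := htx (t + 1) (Finset.mem_Icc.mpr ⟨by omega, ht⟩)
      rw [fwfRun_succ]
      refine h.step hk0 hT.le hTw hw hR hv0 hvT ?_ hmono hwin
      rw [DValue_succ]
      split_ifs <;> linarith
  obtain ⟨f, U, h⟩ := hinv n le_rfl
  exact h.le_mul_settled_add hk0 hw0 hTw.le hR1 hmono hwin |>.trans (by rw [VFWF, hCw])
end

section
/- (FlushAll is 3-competitive when the maximum transaction size equals the wallet size.) Let C > 0 be a real, k ≥ 2 an integer, F ≥ 1 an integer flush period, and let the maximum transaction size be T = C/k (so r = kT/C = 1). Then there is a constant c₀ ≥ 0 depending only on C, k, F such that for every n and every transaction sequence tx of length n with values in [0, C/k], OPT_D(C,k;tx) ≤ 3 · V_FA(tx) + c₀. -/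
open Finset

/-- If any two distinct members of a family of `k ≥ 2` reals sum to less than `W`, then the
whole family sums to less than `k * W / 2`. -/
lemma two_mul_sum_lt_of_pairwise_add_lt {k : ℕ} (hk : 2 ≤ k) {W : ℝ} {c : ℕ → ℝ}
    (h : ∀ i j, i < j → j < k → c i + c j < W) :
    2 * ∑ i ∈ range k, c i < k * W := by
  obtain ⟨m, rfl⟩ := Nat.exists_eq_add_of_le' hk
  have hrot : ∑ i : Fin (m + 2), c (i + 1 : Fin (m + 2)) = ∑ i : Fin (m + 2), c i :=
    Equiv.sum_comp (Equiv.addRight (1 : Fin (m + 2))) (fun i => c i)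
  have hlt : ∑ i : Fin (m + 2), (c i + c (i + 1 : Fin (m + 2))) < ∑ _i : Fin (m + 2), W := by
    refine sum_lt_sum_of_nonempty univ_nonempty fun i _ => ?_
    have hne : i ≠ i + 1 := by simp
    rcases lt_or_gt_of_ne hne with hi | hi
    · exact h _ _ hi (i + 1).isLt
    · rw [add_comm]
      exact h _ _ hi i.isLt
  rw [sum_add_distrib, hrot] at hlt
  simp only [sum_const, card_univ, Fintype.card_fin, nsmul_eq_mul] at hlt
  rw [sum_range]
  linarith

/-- In `F + 1` consecutive slots a single wallet settles at most its size. -/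
lemma DFeasible.sum_wallet_window_le {F : ℕ} {C : ℝ} {k n : ℕ} {tx : ℕ → ℝ}
    {s : ℕ → Option ℕ} {Φ : ℕ → Finset ℕ} (h : DFeasible F C k n tx s Φ) (hC : 0 ≤ C)
    (htx : ∀ t ∈ Icc 1 n, 0 ≤ tx t) {a b : ℕ} (ha : 1 ≤ a) (hab : b ≤ a + F) (i : ℕ) :
    ∑ t ∈ Icc a b with s t = some i, tx t ≤ C / k := by
  rcases ((Icc a b).filter (fun t => s t = some i)).eq_empty_or_nonempty with he | hne
  · rw [he, sum_empty]
    positivity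
  · obtain ⟨t, ht, hmax⟩ := exists_max_image _ id hne
    simp only [mem_filter, mem_Icc, id] at ht hmax
    obtain ⟨⟨hat, htb⟩, hst⟩ := ht
    obtain ⟨hon, hle⟩ := h.2.2 t i hst
    have htn := mem_Icc.1 (h.2.1 t i hst).2
    refine le_trans (sum_le_sum_of_subset_of_nonneg (fun t' ht' => ?_) fun t' ht' _ => ?_) hle
    · have hm := hmax t'
      simp only [mem_filter, mem_Icc] at ht' ⊢
      refine ⟨⟨by omega, hm ht'⟩, ht'.2, fun u hu hut => hon ⟨u, hu, hut.2, by omega⟩⟩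
    · simp only [mem_filter, mem_Icc] at ht'
      exact htx t' (mem_Icc.2 ⟨by omega, by omega⟩)

/-- In `F + 1` consecutive slots all wallets together settle at most the total collateral. -/
lemma DFeasible.sum_window_le {F : ℕ} {C : ℝ} {k n : ℕ} {tx : ℕ → ℝ}
    {s : ℕ → Option ℕ} {Φ : ℕ → Finset ℕ} (h : DFeasible F C k n tx s Φ) (hC : 0 ≤ C)
    (hk : k ≠ 0) (htx : ∀ t ∈ Icc 1 n, 0 ≤ tx t) {a b : ℕ} (ha : 1 ≤ a) (hab : b ≤ a + F) :
    ∑ t ∈ Icc a b, (if (s t).isSome then tx t else 0) ≤ C := by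
  have hsplit : ∀ t, (if (s t).isSome then tx t else 0)
      = ∑ i ∈ range k, if s t = some i then tx t else 0 := by
    intro t
    cases hst : s t with
    | none => simp
    | some j => simp [(h.2.1 t j hst).1]
  calc ∑ t ∈ Icc a b, (if (s t).isSome then tx t else 0)
      = ∑ i ∈ range k, ∑ t ∈ Icc a b with s t = some i, tx t := by
        simp_rw [hsplit, sum_filter]
        exact sum_comm
    _ ≤ ∑ _i ∈ range k, C / k :=
        sum_le_sum fun i _ => h.sum_wallet_window_le hC htx ha hab i
    _ = C := by
        rw [sum_const, card_range, nsmul_eq_mul]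
        field_simp

lemma faRun_succ (C : ℝ) (k F n : ℕ) (tx : ℕ → ℝ) :
    faRun C k F (n + 1) tx = faStep C k F (faRun C k F n tx) (n + 1) (tx (n + 1)) := by
  simp [faRun, List.range_succ]

/-- The first-fit invariant: no wallet exceeds its size, and a wallet in use has less
than one wallet's worth of free space together with any wallet of smaller index. -/
def FirstFit (W : ℝ) (k : ℕ) (c : ℕ → ℝ) : Prop :=
  (∀ i, c i ≤ W) ∧ ∀ i j, i < j → j < k → c j < W → c i + c j < W

lemma FirstFit.settle {W : ℝ} {k : ℕ} {c : ℕ → ℝ} (h : FirstFit W k c) {v : ℝ} (hv : 0 ≤ v)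
    {m : ℕ} (hm : ∀ i < m, c i < v) :
    FirstFit W k (fun j => if j = m then c m - v else c j) := by
  refine ⟨fun i => ?_, fun i j hij hj => ?_⟩
  · have := h.1 i
    dsimp only
    split_ifs with hi
    · subst hi; linarith
    · exact this
  · have hjW := h.1 j
    have hp := h.2 i j hij hj
    dsimp only
    split_ifs with hj' hi hi
    · omega
    · subst hj'
      intro _
      linarith [hm i hij]
    · subst hi
      intro hlt
      linarith [hp hlt]
    · exact hp

/-- A transaction of size at most `W` that fits in no wallet finds the wallets more than
half full. -/
lemma FirstFit.lt_two_mul_sum_used {W : ℝ} {k : ℕ} {c : ℕ → ℝ} (h : FirstFit W k c)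
    (hk : 2 ≤ k) {v : ℝ} (hv : v ≤ W) (hfull : ∀ i < k, c i < v) :
    k * W < 2 * ∑ i ∈ range k, (W - c i) := by
  have := two_mul_sum_lt_of_pairwise_add_lt hk (W := W) (c := c)
    fun i j hij hj => h.2 i j hij hj ((hfull j hj).trans_le hv)
  rw [sum_sub_distrib, sum_const, card_range, nsmul_eq_mul]
  linarith

lemma sum_used_settle {W : ℝ} {k : ℕ} (c : ℕ → ℝ) (v : ℝ) {m : ℕ} (hm : m < k) :
    ∑ i ∈ range k, (W - if i = m then c m - v else c i)
      = ∑ i ∈ range k, (W - c i) + v := by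
  have : ∀ i, (W - if i = m then c m - v else c i) = (W - c i) + if i = m then v else 0 := by
    intro i
    split_ifs with hi
    · subst hi; ring
    · ring
  simp_rw [this, sum_add_distrib]
  simp [hm]

/-- The amortized comparison of `FlushAll` with an arbitrary sequence of settled values `w`
that is dominated by `tx` and bounded by `C` on every `F + 1` consecutive slots. While
`FlushAll` is offline, the surplus from the completed phase pays for the window that started
with the flush. -/
lemma faRun_invariant {C : ℝ} {k F n : ℕ} {tx w : ℕ → ℝ} (hk : 2 ≤ k) (hF : 1 ≤ F)
    (htx : ∀ t ∈ Icc 1 n, 0 ≤ tx t ∧ tx t ≤ C / k) (hw : ∀ t, t ∈ Icc 1 n → w t ≤ tx t)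
    (hwin : ∀ a b, 1 ≤ a → b ≤ a + F → ∑ t ∈ Icc a b, w t ≤ C) (m : ℕ) (hm : m ≤ n) :
    FirstFit (C / k) k (faRun C k F m tx).cap ∧
    ∑ t ∈ Icc 1 m, w t ≤ 3 * (faRun C k F m tx).settled
      - 2 * ∑ i ∈ range k, (C / k - (faRun C k F m tx).cap i) ∧
    (m < (faRun C k F m tx).offlineUntil →
      ∃ a, 1 ≤ a ∧ a ≤ m ∧ (faRun C k F m tx).offlineUntil = a + F ∧
        (faRun C k F m tx).cap = (fun _ => C / k) ∧
        ∑ t ∈ Icc 1 m, w t ≤ 3 * (faRun C k F m tx).settled - C + ∑ t ∈ Icc a m, w t) := by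
  have hkC : (k : ℝ) * (C / k) = C := by
    have : (k : ℝ) ≠ 0 := by positivity
    field_simp
  induction m with
  | zero => simp [faRun, FirstFit]
  | succ m ih =>
    obtain ⟨hfit, hA, hB⟩ := ih (by omega)
    rw [faRun_succ]
    generalize faRun C k F m tx = st at hfit hA hB
    have hmem : m + 1 ∈ Icc 1 n := mem_Icc.2 ⟨by omega, hm⟩
    obtain ⟨hv0, hvW⟩ := htx _ hmem
    have hwv := hw _ hmem
    have hsum : ∑ t ∈ Icc 1 (m + 1), w t = ∑ t ∈ Icc 1 m, w t + w (m + 1) :=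
      sum_Icc_succ_top (by omega) _
    unfold faStep
    split_ifs with hoff hex
    · obtain ⟨a, ha1, ham, hL, hcap, hle⟩ := hB (by omega)
      have hsum' : ∑ t ∈ Icc a (m + 1), w t = ∑ t ∈ Icc a m, w t + w (m + 1) :=
        sum_Icc_succ_top (by omega) _
      refine ⟨hfit, ?_, fun _ => ⟨a, ha1, by omega, hL, hcap, by linarith⟩⟩
      have := hwin a (m + 1) ha1 (by omega)
      simp only [hcap, sub_self, sum_const_zero]
      linarith
    · obtain ⟨hlt, -⟩ := Nat.find_spec hex
      have hmin : ∀ i < Nat.find hex, st.cap i < tx (m + 1) := by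
        intro i hi
        have := Nat.find_min hex hi
        push Not at this
        exact this (by omega)
      refine ⟨hfit.settle hv0 hmin, ?_, fun h => absurd h.le hoff⟩
      dsimp only
      rw [sum_used_settle _ _ hlt]
      linarith
    · push Not at hex
      have hhalf := hfit.lt_two_mul_sum_used hk hvW hex
      have hw1 := hwin (m + 1) (m + 1) (by omega) (by omega)
      rw [hkC] at hhalf
      simp only [Icc_self, sum_singleton] at hw1
      refine ⟨⟨fun _ => le_rfl, fun _ _ _ _ h => absurd h (lt_irrefl _)⟩, ?_,
        fun _ => ⟨m + 1, by omega, le_rfl, rfl, rfl, ?_⟩⟩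
      · simp only [sub_self, sum_const_zero]
        linarith
      · simp only [Icc_self, sum_singleton]
        linarith

/-- `FlushAll` is 3-competitive when the maximum transaction size equals
the wallet size `C / k` (i.e. `r = 1`), for any `k ≥ 2`. -/
theorem flushAll_three_competitive (C : ℝ) (k F : ℕ)
    (hC : 0 < C) (hk : 2 ≤ k) (hF : 1 ≤ F) :
    ∃ c₀ : ℝ, 0 ≤ c₀ ∧ ∀ (n : ℕ) (tx : ℕ → ℝ),
      (∀ t ∈ Finset.Icc 1 n, 0 ≤ tx t ∧ tx t ≤ C / k) →
      ∀ (s : ℕ → Option ℕ) (Φ : ℕ → Finset ℕ), DFeasible F C k n tx s Φ →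
        DValue n tx s ≤ 3 * VFA C k F n tx + c₀ := by
  refine ⟨0, le_rfl, fun n tx htx s Φ h => ?_⟩
  obtain ⟨hfit, hA, -⟩ := faRun_invariant (w := fun t => if (s t).isSome then tx t else 0)
    hk hF htx (fun t ht => by
      split_ifs
      · exact le_rfl
      · exact (htx t ht).1)
    (fun a b ha hab => h.sum_window_le hC.le (by omega) (fun t ht => (htx t ht).1) ha hab)
    n le_rfl
  have hused : 0 ≤ ∑ i ∈ range k, (C / k - (faRun C k F n tx).cap i) :=
    sum_nonneg fun i _ => sub_nonneg.2 (hfit.1 i)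
  rw [DValue, sum_filter, VFA]
  linarith
end

section
/- (Competitive ratio of A_η in the general collateral model with profit margin and flush cost.) Let C > 0, T ≥ 0, F ≥ 1 an integer flush period, p ∈ (0,1), τ > 0, and let η be a real with T/C ≤ η ≤ 1, η + T/C < 1, and ηCp > τ. Set α = (1/(1 − η − T/C)) · ((p/τ − 1/C)/(p/τ − 1/(ηC))). Then there is a constant c₀ ≥ 0 depending only on C, T, F, p, τ, η such that for every n and every transaction sequence tx of length n with maximum transaction size T, OPT_P(C,τ,p;tx) ≤ α · (p·V_{A_η}(tx) − τ·f_{A_η}(tx)) + c₀. -/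
open Finset

/-! ### Invariants of the threshold algorithm -/

lemma etaRun_succ (C η : ℝ) (F m : ℕ) (tx : ℕ → ℝ) :
    etaRun C η F (m + 1) tx = etaStep C η F (etaRun C η F m tx) (m + 1) (tx (m + 1)) := by
  simp [etaRun, List.range_succ]

/-- After `m` steps, the amount scheduled to return at time `u` is what was flushed at time
`u - (F + 1)`. -/
lemma etaRun_ret (C η : ℝ) (F m : ℕ) (tx : ℕ → ℝ) (u : ℕ) :
    (etaRun C η F m tx).ret u = η * C * ((fEta C η F (min (u - (F + 1)) m) tx : ℝ) -
      fEta C η F (min (u - (F + 2)) m) tx) := by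
  induction m with
  | zero => simp [etaRun, fEta]
  | succ m ih =>
    rcases lt_trichotomy u (m + 1 + F + 1) with hu | hu | hu
    · have hret : (etaRun C η F (m + 1) tx).ret u = (etaRun C η F m tx).ret u := by
        rw [etaRun_succ]
        simp only [etaStep]
        split_ifs <;> simp [hu.ne]
      have h₁ : min (u - (F + 1)) (m + 1) = min (u - (F + 1)) m := by omega
      have h₂ : min (u - (F + 2)) (m + 1) = min (u - (F + 2)) m := by omega
      rw [hret, ih, h₁, h₂]
    · have h₁ : min (u - (F + 1)) (m + 1) = m + 1 := by omega
      have h₂ : min (u - (F + 2)) (m + 1) = m := by omega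
      have h₃ : min (u - (F + 1)) m = m := by omega
      have h₄ : min (u - (F + 2)) m = m := by omega
      rw [h₁, h₂]
      rw [h₃, h₄, sub_self, mul_zero] at ih
      simp only [fEta]
      rw [etaRun_succ]
      simp only [etaStep]
      split_ifs <;> simp [hu, hu ▸ ih]
    · have hret : (etaRun C η F (m + 1) tx).ret u = (etaRun C η F m tx).ret u := by
        rw [etaRun_succ]
        simp only [etaStep]
        split_ifs <;> simp [hu.ne']
      have h₁ : min (u - (F + 1)) (m + 1) = m + 1 := by omega
      have h₂ : min (u - (F + 2)) (m + 1) = m + 1 := by omega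
      have h₃ : min (u - (F + 1)) m = m := by omega
      have h₄ : min (u - (F + 2)) m = m := by omega
      rw [hret, ih, h₁, h₂, h₃, h₄, sub_self, sub_self]

lemma etaRun_avail_add_ret (C η : ℝ) (F m : ℕ) (tx : ℕ → ℝ)
    (havail : (etaRun C η F m tx).avail =
      C - VEta C η F m tx + η * C * fEta C η F (m - (F + 1)) tx) :
    (etaRun C η F m tx).avail + (etaRun C η F m tx).ret (m + 1) =
      C - VEta C η F m tx + η * C * fEta C η F (m + 1 - (F + 1)) tx := by
  have h₁ : min (m + 1 - (F + 1)) m = m + 1 - (F + 1) := by omega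
  have h₂ : min (m + 1 - (F + 2)) m = m - (F + 1) := by omega
  rw [havail, etaRun_ret, h₁, h₂]
  ring

lemma etaRun_avail (C η : ℝ) (F m : ℕ) (tx : ℕ → ℝ) :
    (etaRun C η F m tx).avail =
      C - VEta C η F m tx + η * C * fEta C η F (m - (F + 1)) tx := by
  induction m with
  | zero => simp [etaRun, VEta, fEta]
  | succ m ih =>
    have h := etaRun_avail_add_ret C η F m tx ih
    have hV : VEta C η F (m + 1) tx =
        (etaStep C η F (etaRun C η F m tx) (m + 1) (tx (m + 1))).settled := by
      rw [VEta, etaRun_succ]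
    rw [hV, etaRun_succ]
    rw [VEta] at h
    simp only [etaStep]
    split_ifs <;> simp only <;> linarith

lemma VEta_eq_committed_add (C η : ℝ) (F m : ℕ) (tx : ℕ → ℝ) :
    VEta C η F m tx = (etaRun C η F m tx).committed + η * C * fEta C η F m tx := by
  induction m with
  | zero => simp [etaRun, VEta, fEta]
  | succ m ih =>
    simp only [VEta, fEta] at ih ⊢
    rw [etaRun_succ]
    simp only [etaStep]
    split_ifs <;> push_cast <;> linarith

lemma etaRun_committed_mem {C η T : ℝ} {F n : ℕ} {tx : ℕ → ℝ} (hpos : 0 < η * C)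
    (hT : T ≤ η * C) (htx : ∀ t ∈ Finset.Icc 1 n, 0 ≤ tx t ∧ tx t ≤ T) {m : ℕ} (hm : m ≤ n) :
    (etaRun C η F m tx).committed ∈ Set.Ico 0 (η * C) := by
  induction m with
  | zero => simpa [etaRun] using hpos
  | succ m ih =>
    obtain ⟨h₀, h₁⟩ := ih (by omega)
    obtain ⟨hv₀, hv₁⟩ := htx (m + 1) (Finset.mem_Icc.2 ⟨by omega, hm⟩)
    rw [etaRun_succ]
    simp only [etaStep]
    split_ifs <;> constructor <;> simp only <;> linarith

/-- At each step, `A_η` either settles the transaction, or has settled more than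
`C - η C - T` during the last `F + 1` slots. -/
lemma VEta_succ_or {C η T : ℝ} {F n : ℕ} {tx : ℕ → ℝ} (hpos : 0 < η * C)
    (hT : T ≤ η * C) (htx : ∀ t ∈ Finset.Icc 1 n, 0 ≤ tx t ∧ tx t ≤ T) {m : ℕ} (hm : m < n) :
    VEta C η F (m + 1) tx = VEta C η F m tx + tx (m + 1) ∨
      C - η * C - T + VEta C η F (m + 1 - (F + 1)) tx ≤ VEta C η F (m + 1) tx := by
  have hU := etaRun_avail_add_ret C η F m tx (etaRun_avail C η F m tx)
  by_cases hv : tx (m + 1) ≤ (etaRun C η F m tx).avail + (etaRun C η F m tx).ret (m + 1)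
  · left
    rw [VEta, etaRun_succ]
    simp only [etaStep, if_pos hv]
    split_ifs <;> rfl
  · right
    have hV : VEta C η F (m + 1) tx = VEta C η F m tx := by
      rw [VEta, etaRun_succ]
      simp only [etaStep, if_neg hv]
      rfl
    have hR := (etaRun_committed_mem (F := F) hpos hT htx
      (show m + 1 - (F + 1) ≤ n by omega)).2
    have hVf := VEta_eq_committed_add C η F (m + 1 - (F + 1)) tx
    have hv₁ := (htx (m + 1) (Finset.mem_Icc.2 ⟨by omega, hm⟩)).2
    rw [hU] at hv
    linarith

/-! ### Bounds on feasible executions -/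

/-- The total amount of the flush events of `L` whose time satisfies `P`. -/
def flushedOn (L : List (ℕ × ℝ)) (P : ℕ → Prop) [DecidablePred P] : ℝ :=
  ((L.filter (fun e => decide (P e.1))).map Prod.snd).sum

lemma flushedOn_mono {L : List (ℕ × ℝ)} (hL : ∀ e ∈ L, 0 < e.2) {P Q : ℕ → Prop}
    [DecidablePred P] [DecidablePred Q] (hPQ : ∀ t, P t → Q t) :
    flushedOn L P ≤ flushedOn L Q := by
  induction L with
  | nil => simp [flushedOn]
  | cons a L ih =>
    have ha := hL a (by simp)
    have ih := ih fun e he => hL e (by simp [he])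
    simp only [flushedOn, List.filter_cons] at ih ⊢
    by_cases hP : P a.1
    · simpa [hP, hPQ _ hP] using ih
    · by_cases hQ : Q a.1 <;> simp [hP, hQ] <;> linarith

lemma flushedOn_add_le {L : List (ℕ × ℝ)} (hL : ∀ e ∈ L, 0 < e.2) {P Q : ℕ → Prop}
    [DecidablePred P] [DecidablePred Q] (hPQ : ∀ t, P t → Q t) {e : ℕ × ℝ} (he : e ∈ L)
    (heP : ¬ P e.1) (heQ : Q e.1) :
    flushedOn L P + e.2 ≤ flushedOn L Q := by
  induction L with
  | nil => simp at he
  | cons a L ih =>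
    have ha := hL a (by simp)
    have hL' : ∀ e ∈ L, 0 < e.2 := fun e he => hL e (by simp [he])
    rcases List.mem_cons.1 he with rfl | he
    · have h := flushedOn_mono hL' hPQ
      simp only [flushedOn, List.filter_cons] at h ⊢
      simp [heP, heQ]
      linarith
    · have ih := ih hL' he
      simp only [flushedOn, List.filter_cons] at ih ⊢
      by_cases hP : P a.1
      · simp [hP, hPQ _ hP]
        linarith
      · by_cases hQ : Q a.1 <;> simp [hP, hQ] <;> linarith

lemma flushedOn_nonneg {L : List (ℕ × ℝ)} (hL : ∀ e ∈ L, 0 < e.2) (P : ℕ → Prop)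
    [DecidablePred P] : 0 ≤ flushedOn L P := by
  have h := flushedOn_mono hL (P := fun _ => False) (Q := P) (fun _ => False.elim)
  simpa [flushedOn] using h

/-- The total value of the part of `S` up to time `m`. -/
def settledUpTo (tx : ℕ → ℝ) (S : Finset ℕ) (m : ℕ) : ℝ := ∑ t ∈ S.filter (fun t => t ≤ m), tx t

section PFeasible

variable {F n : ℕ} {C : ℝ} {tx : ℕ → ℝ} {S : Finset ℕ} {L : List (ℕ × ℝ)}

lemma PFeasible.settledUpTo_le (h : PFeasible F C n tx S L) (hC : 0 ≤ C) (m : ℕ) :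
    settledUpTo tx S m ≤ C + flushedOn L (fun t => t + F < m) := by
  obtain ⟨-, hL, -, hcol⟩ := h
  have hL' : ∀ e ∈ L, 0 < e.2 := fun e he => (hL e he).2
  rcases (S.filter (fun t => t ≤ m)).eq_empty_or_nonempty with hS | hS
  · rw [settledUpTo, hS, Finset.sum_empty]
    exact add_nonneg hC (flushedOn_nonneg hL' _)
  · obtain ⟨s, hs, hmax⟩ := (S.filter (fun t => t ≤ m)).exists_max_image id hS
    obtain ⟨hsS, hsm⟩ := Finset.mem_filter.1 hs
    have heq : S.filter (fun t => t ≤ m) = S.filter (fun t => t ≤ s) := by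
      ext t
      simp only [Finset.mem_filter, and_congr_right_iff]
      exact fun ht => ⟨fun htm => hmax t (Finset.mem_filter.2 ⟨ht, htm⟩), fun hts => hts.trans hsm⟩
    have h₁ := hcol s hsS
    have h₂ : flushedOn L (fun t => t + F < s) ≤ flushedOn L (fun t => t + F < m) :=
      flushedOn_mono hL' fun t ht => ht.trans_le hsm
    rw [settledUpTo, heq]
    rw [flushedOn] at h₂
    linarith

lemma PFeasible.settledUpTo_window (h : PFeasible F C n tx S L) (hC : 0 ≤ C) (m : ℕ) :
    settledUpTo tx S m ≤ C + settledUpTo tx S (m - (F + 1)) := by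
  have hL' : ∀ e ∈ L, 0 < e.2 := fun e he => (h.2.1 e he).2
  have h₁ := h.settledUpTo_le hC m
  have h₂ : flushedOn L (fun t => t + F < m) ≤ flushedOn L (fun t => t ≤ m - (F + 1)) :=
    flushedOn_mono hL' fun t ht => by omega
  have h₃ : flushedOn L (fun t => t ≤ m - (F + 1)) ≤ settledUpTo tx S (m - (F + 1)) :=
    h.2.2.1 (m - (F + 1))
  linarith

lemma PFeasible.flush_le (h : PFeasible F C n tx S L) (hC : 0 ≤ C) {e : ℕ × ℝ} (he : e ∈ L) :
    e.2 ≤ C := by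
  have hL' : ∀ e ∈ L, 0 < e.2 := fun e he => (h.2.1 e he).2
  have h₁ := h.settledUpTo_le hC e.1
  have h₂ : flushedOn L (fun t => t ≤ e.1) ≤ settledUpTo tx S e.1 := h.2.2.1 e.1
  have h₃ : flushedOn L (fun t => t + F < e.1) + e.2 ≤ flushedOn L (fun t => t ≤ e.1) :=
    flushedOn_add_le hL' (fun t ht => by omega) he (by omega) le_rfl
  linarith

lemma PFeasible.settledUpTo_self (h : PFeasible F C n tx S L) :
    settledUpTo tx S n = ∑ t ∈ S, tx t := by
  rw [settledUpTo, Finset.filter_true_of_mem fun t ht => (Finset.mem_Icc.1 (h.1 ht)).2]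

lemma PFeasible.sum_le_length (h : PFeasible F C n tx S L) (hC : 0 ≤ C) :
    ∑ t ∈ S, tx t ≤ C + C * L.length := by
  have hL' : ∀ e ∈ L, 0 < e.2 := fun e he => (h.2.1 e he).2
  have h₁ := h.settledUpTo_le hC n
  have h₂ : flushedOn L (fun t => t + F < n) ≤ flushedOn L (fun _ => True) :=
    flushedOn_mono hL' fun t _ => trivial
  have h₃ : flushedOn L (fun _ => True) ≤ C * L.length := by
    have := List.sum_le_card_nsmul (L.map Prod.snd) C (by
      intro x hx
      obtain ⟨e, he, rfl⟩ := List.mem_map.1 hx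
      exact h.flush_le hC he)
    simpa [flushedOn, mul_comm] using this
  rw [h.settledUpTo_self] at h₁
  linarith

lemma settledUpTo_succ_le {m : ℕ} (hv : 0 ≤ tx (m + 1)) :
    settledUpTo tx S (m + 1) ≤ settledUpTo tx S m + tx (m + 1) := by
  simp only [settledUpTo]
  by_cases hS : m + 1 ∈ S
  · have heq : S.filter (fun t => t ≤ m + 1) = insert (m + 1) (S.filter (fun t => t ≤ m)) := by
      ext t
      simp only [Finset.mem_filter, Finset.mem_insert]
      grind
    rw [heq, Finset.sum_insert (by simp)]
    linarith
  · have heq : S.filter (fun t => t ≤ m + 1) = S.filter (fun t => t ≤ m) := by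
      ext t
      simp only [Finset.mem_filter]
      grind
    rw [heq]
    linarith

/-- `A_η` is `1 / (1 - η - T / C)`-competitive with respect to the settled value. -/
lemma PFeasible.settledUpTo_competitive {η T : ℝ} (h : PFeasible F C n tx S L) (hC : 0 ≤ C)
    (hpos : 0 < η * C) (hT₀ : 0 ≤ T) (hT : T ≤ η * C) (hD : 0 ≤ C - η * C - T)
    (htx : ∀ t ∈ Finset.Icc 1 n, 0 ≤ tx t ∧ tx t ≤ T) {m : ℕ} (hm : m ≤ n) :
    (C - η * C - T) * settledUpTo tx S m ≤ C * VEta C η F m tx := by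
  induction m using Nat.strong_induction_on with
  | _ m ih =>
    rcases m with _ | m
    · have hS : S.filter (fun t => t ≤ 0) = ∅ :=
        Finset.filter_false_of_mem fun t ht => by have := Finset.mem_Icc.1 (h.1 ht); omega
      rw [settledUpTo, hS]
      simp [VEta, etaRun]
    · rcases VEta_succ_or (F := F) hpos hT htx hm with hV | hV
      · have hv := (htx (m + 1) (Finset.mem_Icc.2 ⟨by omega, hm⟩)).1
        have h₁ := mul_le_mul_of_nonneg_left (settledUpTo_succ_le (S := S) hv) hD
        have h₂ := ih m (by omega) (by omega)
        have h₃ : (C - η * C - T) * tx (m + 1) ≤ C * tx (m + 1) :=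
          mul_le_mul_of_nonneg_right (by linarith) hv
        rw [hV]
        linarith
      · have h₁ := mul_le_mul_of_nonneg_left (h.settledUpTo_window hC (m + 1)) hD
        have h₂ := ih (m + 1 - (F + 1)) (by omega) (by omega)
        have h₃ := mul_le_mul_of_nonneg_left hV hC
        linarith

end PFeasible

/-- Competitive ratio of `A_η` in the general collateral model with
profit margin `p` and flush cost `τ`: every feasible execution achieves profit at most
`α · (p·V_{A_η}(tx) − τ·f_{A_η}(tx)) + c₀` where
`α = (1/(1 − η − T/C)) · ((p/τ − 1/C)/(p/τ − 1/(ηC)))`. -/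
theorem eta_profit_competitive (C T η p τ : ℝ) (F : ℕ)
    (hC : 0 < C) (hT : 0 ≤ T) (hF : 1 ≤ F)
    (hp0 : 0 < p) (hp1 : p < 1) (hτ : 0 < τ)
    (hη₁ : T / C ≤ η) (hη₂ : η ≤ 1) (hη₃ : η + T / C < 1) (hητ : τ < η * C * p) :
    ∃ c₀ : ℝ, 0 ≤ c₀ ∧ ∀ (n : ℕ) (tx : ℕ → ℝ),
      (∀ t ∈ Finset.Icc 1 n, 0 ≤ tx t ∧ tx t ≤ T) →
      ∀ (S : Finset ℕ) (L : List (ℕ × ℝ)), PFeasible F C n tx S L →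
        PProfit p τ tx S L ≤
          ((1 / (1 - η - T / C)) * ((p / τ - 1 / C) / (p / τ - 1 / (η * C)))) *
            (p * VEta C η F n tx - τ * (fEta C η F n tx : ℝ)) + c₀ := by
  refine ⟨τ, hτ.le, fun n tx htx S L h => ?_⟩
  have hpos : 0 < η * C := pos_of_mul_pos_left (hτ.trans hητ) hp0.le
  have hTη : T ≤ η * C := (div_le_iff₀ hC).1 hη₁
  have hd : 0 < 1 - η - T / C := by linarith
  have hdC : C - η * C - T = (1 - η - T / C) * C := by field_simp
  have hA : 0 < p / τ - 1 / (η * C) := by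
    rw [sub_pos, div_lt_div_iff₀ hpos hτ]
    linarith
  have hB : 0 < p / τ - 1 / C := by
    have : 1 / C ≤ 1 / (η * C) := one_div_le_one_div_of_le hpos (mul_le_of_le_one_left hC.le hη₂)
    linarith
  set V := VEta C η F n tx
  set X := ∑ t ∈ S, tx t
  set d := 1 - η - T / C
  have hval : X ≤ 1 / d * V := by
    have hcomp := h.settledUpTo_competitive hC.le hpos hT hTη
      (by rw [hdC]; positivity) htx le_rfl
    rw [h.settledUpTo_self, hdC] at hcomp
    rw [one_div_mul_eq_div, le_div_iff₀ hd]
    exact le_of_mul_le_mul_left (by linarith) hC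
  have hopt : PProfit p τ tx S L ≤ τ * (p / τ - 1 / C) * X + τ := by
    have hlen : X / C ≤ 1 + L.length := by
      rw [div_le_iff₀ hC]
      linarith [h.sum_le_length hC.le]
    have heq : τ * (p / τ - 1 / C) * X = p * X - τ * (X / C) := by field_simp
    rw [PProfit, heq]
    linarith [mul_le_mul_of_nonneg_left hlen hτ.le]
  have halg : τ * (p / τ - 1 / (η * C)) * V ≤ p * V - τ * (fEta C η F n tx : ℝ) := by
    have hf : (fEta C η F n tx : ℝ) ≤ V / (η * C) := by
      rw [le_div_iff₀ hpos]
      linarith [VEta_eq_committed_add C η F n tx,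
        (etaRun_committed_mem (F := F) hpos hTη htx le_rfl).1]
    have heq : τ * (p / τ - 1 / (η * C)) * V = p * V - τ * (V / (η * C)) := by
      rw [mul_sub, mul_div_cancel₀ _ hτ.ne']
      ring
    rw [heq]
    linarith [mul_le_mul_of_nonneg_left hf hτ.le]
  calc PProfit p τ tx S L ≤ τ * (p / τ - 1 / C) * X + τ := hopt
    _ ≤ τ * (p / τ - 1 / C) * (1 / d * V) + τ := by gcongr
    _ = 1 / d * ((p / τ - 1 / C) / (p / τ - 1 / (η * C))) *
          (τ * (p / τ - 1 / (η * C)) * V) + τ := by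
        generalize p / τ - 1 / (η * C) = a at hA
        field_simp
    _ ≤ _ := by gcongr
end
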